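/- Let n ≥ 2 be an integer, s > n/2 a real number, and θ₀ ∈ (0, π/2]. Every eigenvalue λ of L_s on [0, θ₀] satisfies λ ≥ s(s + 1 − n). -/

import Mathlib

open Real Set Filter

/-- The operator `(L_s u)(θ) = -u''(θ) - (n+1-2s) cot(θ) u'(θ) + (s-1)(s-n) u(θ)`. -/
noncomputable def Ls (n : ℕ) (s : ℝ) (u : ℝ → ℝ) (θ : ℝ) : ℝ :=
  -deriv (deriv u) θ - ((n : ℝ) + 1 - 2 * s) * Real.cot θ * deriv u θ
    + (s - 1) * (s - (n : ℝ)) * u θ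

/-- `lam` is an eigenvalue of `L_s` on `[0, θ₀]`: there is `v`, the restriction of a
`C^∞` function on `ℝ`, not identically zero on `[0, θ₀]`, such that
`u(θ) = sin(θ)^{2s-n} v(θ)` satisfies `L_s u = lam·u` on `(0, θ₀)` and `u'(θ₀) = 0`. -/
def IsEigenvalue (n : ℕ) (s θ₀ lam : ℝ) : Prop :=
  ∃ V : ℝ → ℝ, ContDiff ℝ (⊤ : ℕ∞) V ∧ (∃ θ ∈ Set.Icc 0 θ₀, V θ ≠ 0) ∧
    (∀ θ ∈ Set.Ioo 0 θ₀,
      Ls n s (fun t => Real.sin t ^ (2 * s - (n : ℝ)) * V t) θ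
        = lam * (Real.sin θ ^ (2 * s - (n : ℝ)) * V θ)) ∧
    deriv (fun t => Real.sin t ^ (2 * s - (n : ℝ)) * V t) θ₀ = 0

/-- The product `sin^a · V` has derivative `sin^(a-1) · (a cos · V + sin · V')` where `sin > 0`. -/
theorem hasDerivAt_sin_rpow_mul {V : ℝ → ℝ} {a x d : ℝ} (hx : 0 < Real.sin x)
    (hV : HasDerivAt V d x) :
    HasDerivAt (fun t => Real.sin t ^ a * V t)
      (Real.sin x ^ (a - 1) * (a * Real.cos x * V x + Real.sin x * d)) x := by
  have h := ((Real.hasDerivAt_sin x).rpow_const (p := a) (Or.inl hx.ne')).mul hV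
  refine h.congr_deriv ?_
  have e : Real.sin x ^ a = Real.sin x ^ (a - 1) * Real.sin x := by
    rw [← Real.rpow_add_one hx.ne', sub_add_cancel]
  rw [e]
  ring

/-- The eigenvalue equation for `u = sin^(2s-n) · V`, rewritten as an equation for `V`. -/
theorem reduced_equation_of_Ls_eq {n : ℕ} {s lam x : ℝ} {V : ℝ → ℝ}
    (hV : Differentiable ℝ V) (hV' : Differentiable ℝ (deriv V)) (hx : x ∈ Set.Ioo 0 Real.pi)
    (h : Ls n s (fun t => Real.sin t ^ (2 * s - (n : ℝ)) * V t) x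
      = lam * (Real.sin x ^ (2 * s - (n : ℝ)) * V x)) :
    Real.sin x * deriv (deriv V) x + (2 * s - n + 1) * Real.cos x * deriv V x
      = (s * (s + 1 - n) - lam) * Real.sin x * V x := by
  have hsin : 0 < Real.sin x := Real.sin_pos_of_mem_Ioo hx
  unfold Ls at h
  set a : ℝ := 2 * s - n with ha
  have hu' : deriv (fun t => Real.sin t ^ a * V t) =ᶠ[nhds x]
      fun t => Real.sin t ^ (a - 1) * (a * Real.cos t * V t + Real.sin t * deriv V t) := by
    filter_upwards [isOpen_Ioo.mem_nhds hx] with t ht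
    exact (hasDerivAt_sin_rpow_mul (Real.sin_pos_of_mem_Ioo ht) (hV t).hasDerivAt).deriv
  have hw : HasDerivAt (fun t => a * Real.cos t * V t + Real.sin t * deriv V t)
      (a * -Real.sin x * V x + a * Real.cos x * deriv V x
        + (Real.cos x * deriv V x + Real.sin x * deriv (deriv V) x)) x :=
    (((Real.hasDerivAt_cos x).const_mul a).mul (hV x).hasDerivAt).add
      ((Real.hasDerivAt_sin x).mul (hV' x).hasDerivAt)
  rw [hu'.deriv_eq, (hasDerivAt_sin_rpow_mul hsin hw).deriv, hu'.eq_of_nhds,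
    Real.cot_eq_cos_div_sin] at h
  have hS : 0 < Real.sin x ^ (a - 1 - 1) := Real.rpow_pos_of_pos hsin _
  have e₁ : Real.sin x ^ (a - 1) = Real.sin x ^ (a - 1 - 1) * Real.sin x := by
    rw [← Real.rpow_add_one hsin.ne', sub_add_cancel]
  have e₂ : Real.sin x ^ a = Real.sin x ^ (a - 1 - 1) * Real.sin x * Real.sin x := by
    rw [← e₁, ← Real.rpow_add_one hsin.ne', sub_add_cancel]
  simp only [e₂, e₁] at h
  generalize Real.sin x ^ (a - 1 - 1) = S at h hS
  have hne := hsin.ne'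
  have hn : (n : ℝ) = 2 * s - a := by rw [ha]; ring
  rw [hn] at h ⊢
  field_simp at h
  refine mul_left_cancel₀ hne ?_
  linear_combination -h

/-- for `θ₀ ∈ (0, π/2]`, every eigenvalue of `L_s` on `[0, θ₀]`
is `≥ s(s+1-n)`. -/
theorem stmt_3 (n : ℕ) (hn : 2 ≤ n) (s : ℝ) (hs : (n : ℝ) / 2 < s)
    (θ₀ : ℝ) (hθ₀ : θ₀ ∈ Set.Ioc 0 (Real.pi / 2))
    (lam : ℝ) (hlam : IsEigenvalue n s θ₀ lam) :
    s * (s + 1 - (n : ℝ)) ≤ lam := by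
  obtain ⟨V, hV, ⟨x₀, hx₀, hne⟩, heq, hbd⟩ := hlam
  obtain ⟨hpos, hle⟩ := hθ₀
  have hV2 : ContDiff ℝ 2 V := contDiff_infty.1 hV 2
  have hd : Differentiable ℝ V := hV2.differentiable (by norm_num)
  have hd' : Differentiable ℝ (deriv V) :=
    ((contDiff_succ_iff_deriv (n := 1)).1 hV2).2.2.differentiable (by norm_num)
  by_contra! hlt
  have ha : 0 < 2 * s - n := by linarith
  set a : ℝ := 2 * s - n with ha_def
  have hsin : ∀ x ∈ Set.Ioc 0 θ₀, 0 < Real.sin x := fun x hx =>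
    Real.sin_pos_of_pos_of_lt_pi hx.1 (by linarith [hx.2, Real.pi_pos])
  let F : ℝ → ℝ := fun t => Real.sin t ^ (a + 1) * (deriv V t * V t)
  have hF : ∀ x ∈ Set.Ioo 0 θ₀, HasDerivAt F (Real.sin x ^ (a + 1) *
      (deriv V x ^ 2 + (s * (s + 1 - n) - lam) * V x ^ 2)) x := by
    intro x hx
    have hs0 := hsin x ⟨hx.1, hx.2.le⟩
    have hred := reduced_equation_of_Ls_eq hd hd'
      ⟨hx.1, by linarith [hx.2, Real.pi_pos]⟩ (heq x hx)
    refine (hasDerivAt_sin_rpow_mul hs0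
      ((hd' x).hasDerivAt.mul (hd x).hasDerivAt)).congr_deriv ?_
    rw [Real.rpow_add_one hs0.ne', add_sub_cancel_right]
    simp only [Pi.mul_apply]
    linear_combination Real.sin x ^ a * V x * hred
  have hFc : Continuous F :=
    (Real.continuous_sin.rpow_const fun _ => Or.inr (by linarith)).mul
      (hd'.continuous.mul hd.continuous)
  have hmono : MonotoneOn F (Set.Icc 0 θ₀) := by
    refine monotoneOn_of_deriv_nonneg (convex_Icc _ _) hFc.continuousOn ?_ ?_ <;>
      rw [interior_Icc] <;> intro x hx
    · exact (hF x hx).differentiableAt.differentiableWithinAt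
    · rw [(hF x hx).deriv]
      have hs0 := hsin x ⟨hx.1, hx.2.le⟩
      have hgap := sub_pos.2 hlt
      positivity
  have hF0 : F 0 = 0 := by
    simp [F, Real.zero_rpow (by linarith : a + 1 ≠ 0)]
  have hF1 : F θ₀ ≤ 0 := by
    have hs0 := hsin θ₀ ⟨hpos, le_rfl⟩
    rw [(hasDerivAt_sin_rpow_mul hs0 (hd θ₀).hasDerivAt).deriv] at hbd
    have hw := (mul_eq_zero.1 hbd).resolve_left (Real.rpow_pos_of_pos hs0 _).ne'
    have hc : 0 ≤ Real.cos θ₀ := Real.cos_nonneg_of_mem_Icc ⟨by linarith, hle⟩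
    have hFe : F θ₀ = -(Real.sin θ₀ ^ a * (a * Real.cos θ₀ * V θ₀ ^ 2)) := by
      simp only [F]
      rw [Real.rpow_add_one hs0.ne']
      linear_combination Real.sin θ₀ ^ a * V θ₀ * hw
    rw [hFe, neg_nonpos]
    positivity
  have hFz : ∀ x ∈ Set.Icc 0 θ₀, F x = 0 := fun x hx =>
    le_antisymm ((hmono hx ⟨hpos.le, le_rfl⟩ hx.2).trans hF1)
      (hF0 ▸ hmono ⟨le_rfl, hpos.le⟩ hx hx.1)
  have hVz : Set.EqOn V 0 (Set.Ioo 0 θ₀) := by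
    intro x hx
    have hev : F =ᶠ[nhds x] fun _ => 0 := by
      filter_upwards [isOpen_Ioo.mem_nhds hx] with t ht
      exact hFz t ⟨ht.1.le, ht.2.le⟩
    have h0 := (hF x hx).deriv.symm.trans (hev.deriv_eq.trans (deriv_const x 0))
    have h1 := (mul_eq_zero.1 h0).resolve_left
      (Real.rpow_pos_of_pos (hsin x ⟨hx.1, hx.2.le⟩) _).ne'
    by_contra hVx
    have hVx' : V x ≠ 0 := hVx
    have hgap := sub_pos.2 hlt
    have : 0 < deriv V x ^ 2 + (s * (s + 1 - n) - lam) * V x ^ 2 := by positivity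
    exact this.ne' h1
  have hcl := hVz.closure hd.continuous continuous_zero
  rw [closure_Ioo hpos.ne] at hcl
  exact hne (hcl hx₀)
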